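/- Let Φ be a finite crystallographic root system in ℝⁿ, let s_{β₁},…,s_{β_k} be reflections corresponding to roots β₁,…,β_k ∈ Φ, and let w = s_{β₁}⋯s_{β_k} be an element of the Weyl group W. Then the reflection length ℓ_R(w) equals k if and only if the set of roots {β₁,…,β_k} is linearly independent over ℝ. -/

import Mathlib

open scoped RealInnerProductSpace

abbrev V (n : ℕ) : Type := EuclideanSpace ℝ (Fin n)

/-- `g` is the (orthogonal) reflection corresponding to the root `β`. -/
def IsReflAlong {n : ℕ} (β : V n) (g : V n ≃ₗ[ℝ] V n) : Prop :=
  ∀ v, g v = v - (2 * ⟪v, β⟫ / ⟪β, β⟫) • β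

/-- `Φ` is a finite crystallographic root system spanning `ℝⁿ`. -/
structure IsCrystalRootSystem {n : ℕ} (Φ : Set (V n)) : Prop where
  finite : Φ.Finite
  ne_zero : ∀ β ∈ Φ, β ≠ 0
  spans : Submodule.span ℝ Φ = ⊤
  refl_mem : ∀ α ∈ Φ, ∀ β ∈ Φ, β - (2 * ⟪β, α⟫ / ⟪α, α⟫) • α ∈ Φ
  crystal : ∀ α ∈ Φ, ∀ β ∈ Φ, ∃ z : ℤ, (2 * ⟪β, α⟫ / ⟪α, α⟫) = (z : ℝ)

/-- The reflection length of `w`: the least `k` such that `w` is a product of `k`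
reflections of the root system `Φ`. -/
noncomputable def reflLen {n : ℕ} (Φ : Set (V n)) (w : V n ≃ₗ[ℝ] V n) : ℕ :=
  sInf {k | ∃ l : List (V n ≃ₗ[ℝ] V n), l.length = k ∧
    (∀ g ∈ l, ∃ β ∈ Φ, IsReflAlong β g) ∧ l.prod = w}

/-- The Weyl group of `Φ`: the group generated by the reflections of `Φ`. -/
noncomputable def weylGroup {n : ℕ} (Φ : Set (V n)) : Subgroup (V n ≃ₗ[ℝ] V n) :=
  Subgroup.closure {g | ∃ β ∈ Φ, IsReflAlong β g}

/-- The coroot `β^∨ = 2β/(β,β)` of a root `β`. -/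
noncomputable def coroot {n : ℕ} (β : V n) : V n := (2 / ⟪β, β⟫) • β

/-- The coroot lattice: the `ℤ`-span of the coroots. -/
noncomputable def corootLattice {n : ℕ} (Φ : Set (V n)) : Submodule ℤ (V n) :=
  Submodule.span ℤ (coroot '' Φ)

/-- The move-set `Mov(w) = Im(w - Id)`. -/
noncomputable def movSet {n : ℕ} (w : V n ≃ₗ[ℝ] V n) : Submodule ℝ (V n) :=
  LinearMap.range (w.toLinearMap - LinearMap.id)

/-- The mod-set `Mod(w) = (w - Id)R^∨`. -/
noncomputable def modSet {n : ℕ} (Φ : Set (V n)) (w : V n ≃ₗ[ℝ] V n) : Submodule ℤ (V n) :=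
  Submodule.map ((w.toLinearMap - LinearMap.id).restrictScalars ℤ) (corootLattice Φ)


namespace Carter

/-- The set of reflections of `Φ`. -/
def Refl {n : ℕ} (Φ : Set (V n)) : Set (V n ≃ₗ[ℝ] V n) := {g | ∃ β ∈ Φ, IsReflAlong β g}

section basic
variable {n : ℕ}

lemma exists_refl (β : V n) : ∃ g : V n ≃ₗ[ℝ] V n, IsReflAlong β g := by
  by_cases hβ : β = 0
  · exact ⟨1, fun v => by simp [hβ]⟩
  have hB : ⟪β, β⟫ ≠ 0 := by simpa using hβ
  let f : V n →ₗ[ℝ] V n :=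
    { toFun := fun v => v - (2 * ⟪v, β⟫ / ⟪β, β⟫) • β
      map_add' := by
        intro x y
        rw [inner_add_left]
        module
      map_smul' := by
        intro c x
        rw [real_inner_smul_left]
        simp only [RingHom.id_apply]
        module }
  have hf : ∀ v, f v = v - (2 * ⟪v, β⟫ / ⟪β, β⟫) • β := fun v => rfl
  have hff : f ∘ₗ f = LinearMap.id := by
    apply LinearMap.ext
    intro v
    rw [LinearMap.comp_apply, hf (f v), hf v, inner_sub_left, real_inner_smul_left]
    have : 2 * (⟪v, β⟫ - 2 * ⟪v, β⟫ / ⟪β, β⟫ * ⟪β, β⟫) / ⟪β, β⟫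
        = - (2 * ⟪v, β⟫ / ⟪β, β⟫) := by
      field_simp; ring
    rw [this]
    simp
  exact ⟨LinearEquiv.ofLinearMap f f hff hff, fun v => rfl⟩

lemma refl_inner {β : V n} (hβ : β ≠ 0) {g : V n ≃ₗ[ℝ] V n} (hg : IsReflAlong β g)
    (u v : V n) : ⟪g u, g v⟫ = ⟪u, v⟫ := by
  have hB : ⟪β, β⟫ ≠ 0 := by simpa using hβ
  rw [hg u, hg v]
  simp only [inner_sub_left, inner_sub_right, real_inner_smul_left, real_inner_smul_right]
  rw [real_inner_comm v β]
  field_simp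
  ring

lemma refl_invol {β : V n} (hβ : β ≠ 0) {g : V n ≃ₗ[ℝ] V n} (hg : IsReflAlong β g) :
    g * g = 1 := by
  have hB : ⟪β, β⟫ ≠ 0 := by simpa using hβ
  apply LinearEquiv.ext
  intro v
  show g (g v) = v
  rw [hg (g v), hg v, inner_sub_left, real_inner_smul_left]
  have : 2 * (⟪v, β⟫ - 2 * ⟪v, β⟫ / ⟪β, β⟫ * ⟪β, β⟫) / ⟪β, β⟫
      = - (2 * ⟪v, β⟫ / ⟪β, β⟫) := by
    field_simp; ring
  rw [this]
  simp

lemma refl_invol_apply {β : V n} (hβ : β ≠ 0) {g : V n ≃ₗ[ℝ] V n} (hg : IsReflAlong β g)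
    (v : V n) : g (g v) = v := by
  have := congrArg (fun h : V n ≃ₗ[ℝ] V n => h v) (refl_invol hβ hg)
  exact this

lemma refl_conj {α β : V n} (hα : α ≠ 0) (hβ : β ≠ 0) {a b : V n ≃ₗ[ℝ] V n}
    (ha : IsReflAlong α a) (hb : IsReflAlong β b) : IsReflAlong (a β) (a * b * a) := by
  intro v
  show a (b (a v)) = _
  rw [hb (a v), map_sub, map_smul, refl_invol_apply hα ha, refl_inner hα ha]
  have : ⟪a v, β⟫ = ⟪v, a β⟫ := by
    rw [← refl_inner hα ha (a v) β, refl_invol_apply hα ha]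
  rw [this]

end basic

variable {n : ℕ} {Φ : Set (V n)}

lemma refl_map_mem (hΦ : IsCrystalRootSystem Φ) {a : V n ≃ₗ[ℝ] V n} (ha : a ∈ Refl Φ)
    {β : V n} (hβ : β ∈ Φ) : a β ∈ Φ := by
  obtain ⟨α, hα, ha⟩ := ha
  rw [ha β]
  exact hΦ.refl_mem α hα β hβ

lemma conj_mem (hΦ : IsCrystalRootSystem Φ) {a b : V n ≃ₗ[ℝ] V n} (ha : a ∈ Refl Φ)
    (hb : b ∈ Refl Φ) : a * b * a ∈ Refl Φ := by
  have ha' := ha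
  obtain ⟨α, hα, ha⟩ := ha
  obtain ⟨β, hβ, hb⟩ := hb
  exact ⟨a β, refl_map_mem hΦ ha' hβ, refl_conj (hΦ.ne_zero _ hα) (hΦ.ne_zero _ hβ) ha hb⟩

lemma mul_self (hΦ : IsCrystalRootSystem Φ) {a : V n ≃ₗ[ℝ] V n} (ha : a ∈ Refl Φ) :
    a * a = 1 := by
  obtain ⟨α, hα, ha⟩ := ha
  exact refl_invol (hΦ.ne_zero _ hα) ha

lemma word_inner (hΦ : IsCrystalRootSystem Φ) (l : List (V n ≃ₗ[ℝ] V n))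
    (hl : ∀ g ∈ l, g ∈ Refl Φ) (u v : V n) : ⟪l.prod u, l.prod v⟫ = ⟪u, v⟫ := by
  induction l with
  | nil => simp
  | cons a l ih =>
    obtain ⟨α, hα, ha⟩ := hl a (by simp)
    rw [List.prod_cons]
    show ⟪a (l.prod u), a (l.prod v)⟫ = _
    rw [refl_inner (hΦ.ne_zero _ hα) ha]
    exact ih fun g hg => hl g (by simp [hg])

/-- Words keep regular vectors regular. -/
lemma word_regular (hΦ : IsCrystalRootSystem Φ) (x : V n) (hx : ∀ r ∈ Φ, ⟪x, r⟫ ≠ 0)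
    (l : List (V n ≃ₗ[ℝ] V n))
    (hl : ∀ g ∈ l, g ∈ Refl Φ) : ∀ r ∈ Φ, ⟪l.prod x, r⟫ ≠ 0 := by
  induction l with
  | nil => simpa using hx
  | cons a l ih =>
    intro r hr
    have ha' := hl a (by simp)
    obtain ⟨α, hα, ha⟩ := hl a (by simp)
    rw [List.prod_cons]
    show ⟪a (l.prod x), r⟫ ≠ 0
    rw [← refl_inner (hΦ.ne_zero _ hα) ha, refl_invol_apply (hΦ.ne_zero _ hα) ha]
    exact ih (fun g hg => hl g (by simp [hg])) _ (refl_map_mem hΦ ha' hr)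

lemma refl_finite (hΦ : IsCrystalRootSystem Φ) : (Refl Φ).Finite := by
  choose f hf using fun β : V n => exists_refl β
  refine (hΦ.finite.image f).subset ?_
  rintro g ⟨β, hβ, hg⟩
  refine ⟨β, hβ, ?_⟩
  apply LinearEquiv.ext
  intro v
  rw [hf β v, hg v]

/-- Sum of heights along the path of a word. -/
noncomputable def hsum (x : V n) : List (V n ≃ₗ[ℝ] V n) → ℝ
  | [] => 0
  | a :: l => -⟪(a :: l).prod x, x⟫ + hsum x l

/-- Minimal words. -/
def Mini (Φ : Set (V n)) (x : V n) (l : List (V n ≃ₗ[ℝ] V n)) : Prop :=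
  (∀ g ∈ l, g ∈ Refl Φ) ∧
    ∀ l' : List (V n ≃ₗ[ℝ] V n), (∀ g ∈ l', g ∈ Refl Φ) → l'.prod = l.prod →
      l.length ≤ l'.length ∧ (l'.length = l.length → hsum x l ≤ hsum x l')

lemma Mini.tail {x : V n} {a : V n ≃ₗ[ℝ] V n} {l : List (V n ≃ₗ[ℝ] V n)}
    (h : Mini Φ x (a :: l)) : Mini Φ x l := by
  refine ⟨fun g hg => h.1 g (by simp [hg]), fun l' hl' hp => ?_⟩
  have := h.2 (a :: l') (by
    intro g hg
    rcases List.mem_cons.1 hg with rfl | hg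
    · exact h.1 _ (by simp)
    · exact hl' g hg) (by simp [hp])
  refine ⟨by simpa using this.1, fun hlen => ?_⟩
  have h2 := this.2 (by simp [hlen])
  simp only [hsum, List.prod_cons, hp] at h2
  linarith

lemma exists_mini (hΦ : IsCrystalRootSystem Φ) (x : V n) (l : List (V n ≃ₗ[ℝ] V n))
    (hl : ∀ g ∈ l, g ∈ Refl Φ) : ∃ l', Mini Φ x l' ∧ l'.prod = l.prod := by
  classical
  let P : ℕ → Prop := fun m => ∃ l' : List (V n ≃ₗ[ℝ] V n), l'.length = m ∧
    (∀ g ∈ l', g ∈ Refl Φ) ∧ l'.prod = l.prod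
  have hP : ∃ m, P m := ⟨_, l, rfl, hl, rfl⟩
  let A : Set (List (V n ≃ₗ[ℝ] V n)) := {l' | l'.length = Nat.find hP ∧
    (∀ g ∈ l', g ∈ Refl Φ) ∧ l'.prod = l.prod}
  have hA : A.Finite := by
    have : Finite (Refl Φ) := (refl_finite hΦ).to_subtype
    refine ((List.finite_length_eq (Refl Φ) (Nat.find hP)).image (List.map Subtype.val)).subset ?_
    rintro l' ⟨h1, h2, -⟩
    refine ⟨l'.attach.map fun g => ⟨g.1, h2 g.1 g.2⟩, ?_, ?_⟩
    · simpa using h1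
    · simp [List.map_map, Function.comp_def]
  obtain ⟨l', hl', hmin⟩ := Set.exists_min_image A (hsum x) hA (Nat.find_spec hP)
  refine ⟨l', ⟨hl'.2.1, fun l'' h1 h2 => ⟨?_, fun h3 => ?_⟩⟩, hl'.2.2⟩
  · rw [hl'.1]
    exact Nat.find_min' hP ⟨l'', rfl, h1, h2.trans hl'.2.2⟩
  · exact hmin l'' ⟨h3.trans hl'.1, h1, h2.trans hl'.2.2⟩

lemma peak_arith (A B c pa pb qa qb : ℝ) (hA : 0 < A) (hB : 0 < B) (hc : c ^ 2 < A * B)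
    (ha : pa * qa < 0) (hb : pb * qb < 0)
    (h1 : 0 ≤ (pa * qa) * B + (pb * qb) * A - 2 * (c * pb * qa))
    (h2 : 0 ≤ (pa * qa) * B + (pb * qb) * A - 2 * (c * pa * qb)) : False := by
  set X := -(pa * qa) * B with hX
  set Y := -(pb * qb) * A with hY
  have hX0 : 0 < X := mul_pos (by linarith) hB
  have hY0 : 0 < Y := mul_pos (by linarith) hA
  have e1 : X + Y ≤ -2 * (c * pb * qa) := by linarith
  have e2 : X + Y ≤ -2 * (c * pa * qb) := by linarith
  have e3 : (X + Y) * (X + Y) ≤ (-2 * (c * pb * qa)) * (-2 * (c * pa * qb)) :=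
    mul_le_mul e1 e2 (by linarith) (by linarith)
  have e4 : (-2 * (c * pb * qa)) * (-2 * (c * pa * qb))
      = 4 * (c ^ 2 * ((pa * qa) * (pb * qb))) := by ring
  have e5 : c ^ 2 * ((pa * qa) * (pb * qb)) < A * B * ((pa * qa) * (pb * qb)) :=
    mul_lt_mul_of_pos_right hc (mul_pos_of_neg_of_neg ha hb)
  have e6 : A * B * ((pa * qa) * (pb * qb)) = X * Y := by rw [hX, hY]; ring
  nlinarith [sq_nonneg (X - Y)]

lemma refl_eq_of_parallel {α β : V n} {t : ℝ} (hα : α ≠ 0) (h : α = t • β)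
    {a b : V n ≃ₗ[ℝ] V n} (ha : IsReflAlong α a) (hb : IsReflAlong β b) : a = b := by
  have ht : t ≠ 0 := by rintro rfl; simp at h; exact hα h
  have hβ : β ≠ 0 := by rintro rfl; simp at h; exact hα h
  have hB : ⟪β, β⟫ ≠ 0 := by simpa using hβ
  apply LinearEquiv.ext
  intro v
  rw [ha v, hb v, h, smul_smul]
  congr 2
  simp only [real_inner_smul_left, real_inner_smul_right]
  field_simp

lemma height_refl {α x z : V n} {a : V n ≃ₗ[ℝ] V n} (ha : IsReflAlong α a) :
    ⟪a z, x⟫ = ⟪z, x⟫ - 2 * (⟪z, α⟫ * ⟪x, α⟫) / ⟪α, α⟫ := by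
  rw [ha z, inner_sub_left, real_inner_smul_left, real_inner_comm x α]
  ring

/-- Peak lemma. -/
lemma peak {α β x z : V n} (hα : α ≠ 0) (hβ : β ≠ 0) {a b : V n ≃ₗ[ℝ] V n}
    (ha : IsReflAlong α a) (hb : IsReflAlong β b)
    (h1 : ⟪z, x⟫ < ⟪a z, x⟫) (h2 : ⟪z, x⟫ < ⟪b z, x⟫) (hab : a ≠ b) :
    ⟪z, x⟫ < ⟪a (b z), x⟫ ∨ ⟪z, x⟫ < ⟪b (a z), x⟫ := by
  have hA : 0 < ⟪α, α⟫ := real_inner_self_pos.2 hα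
  have hB : 0 < ⟪β, β⟫ := real_inner_self_pos.2 hβ
  have hc : ⟪α, β⟫ ^ 2 < ⟪α, α⟫ * ⟪β, β⟫ := by
    by_contra hcon
    push Not at hcon
    apply hab
    refine refl_eq_of_parallel (t := ⟪α, β⟫ / ⟪β, β⟫) hα ?_ ha hb
    rw [← sub_eq_zero, ← inner_self_eq_zero (𝕜 := ℝ)]
    apply le_antisymm _ real_inner_self_nonneg
    simp only [inner_sub_left, inner_sub_right, real_inner_smul_left, real_inner_smul_right]
    rw [real_inner_comm α β]
    have : ⟪α, α⟫ - ⟪α, β⟫ / ⟪β, β⟫ * ⟪α, β⟫ -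
        (⟪α, β⟫ / ⟪β, β⟫ * ⟪α, β⟫ - ⟪α, β⟫ / ⟪β, β⟫ * (⟪α, β⟫ / ⟪β, β⟫ * ⟪β, β⟫))
        = (⟪α, α⟫ * ⟪β, β⟫ - ⟪α, β⟫ ^ 2) / ⟪β, β⟫ := by
      field_simp; ring
    refine le_trans (le_of_eq ?_) (div_nonpos_of_nonpos_of_nonneg (sub_nonpos.2 hcon) hB.le)
    rw [← this]
  rw [height_refl ha] at h1
  rw [height_refl hb] at h2
  have h1' : ⟪z, α⟫ * ⟪x, α⟫ < 0 := by
    by_contra hcon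
    push Not at hcon
    have : 0 ≤ 2 * (⟪z, α⟫ * ⟪x, α⟫) / ⟪α, α⟫ := by positivity
    linarith
  have h2' : ⟪z, β⟫ * ⟪x, β⟫ < 0 := by
    by_contra hcon
    push Not at hcon
    have : 0 ≤ 2 * (⟪z, β⟫ * ⟪x, β⟫) / ⟪β, β⟫ := by positivity
    linarith
  by_contra hcon
  push Not at hcon
  obtain ⟨k1, k2⟩ := hcon
  rw [height_refl ha, height_refl hb, height_refl hb] at k1
  rw [height_refl hb, height_refl ha, height_refl ha, real_inner_comm α β] at k2
  refine peak_arith ⟪α, α⟫ ⟪β, β⟫ ⟪α, β⟫ ⟪z, α⟫ ⟪z, β⟫ ⟪x, α⟫ ⟪x, β⟫ hA hB hc h1' h2' ?_ ?_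
  · have e : ∀ Z : ℝ, Z - 2 * (⟪z, β⟫ * ⟪x, β⟫) / ⟪β, β⟫ -
      2 * ((⟪z, α⟫ - 2 * (⟪z, β⟫ * ⟪α, β⟫) / ⟪β, β⟫) * ⟪x, α⟫) / ⟪α, α⟫
      = Z - 2 * (((⟪z, α⟫ * ⟪x, α⟫) * ⟪β, β⟫ + (⟪z, β⟫ * ⟪x, β⟫) * ⟪α, α⟫
        - 2 * (⟪α, β⟫ * ⟪z, β⟫ * ⟪x, α⟫)) / (⟪α, α⟫ * ⟪β, β⟫)) := by
      intro Z; field_simp; ring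
    by_contra hneg
    push Not at hneg
    have := div_neg_of_neg_of_pos hneg (mul_pos hA hB)
    have e' := e ⟪z, x⟫
    linarith
  · have e : ∀ Z : ℝ, Z - 2 * (⟪z, α⟫ * ⟪x, α⟫) / ⟪α, α⟫ -
      2 * ((⟪z, β⟫ - 2 * (⟪z, α⟫ * ⟪α, β⟫) / ⟪α, α⟫) * ⟪x, β⟫) / ⟪β, β⟫
      = Z - 2 * (((⟪z, α⟫ * ⟪x, α⟫) * ⟪β, β⟫ + (⟪z, β⟫ * ⟪x, β⟫) * ⟪α, α⟫
        - 2 * (⟪α, β⟫ * ⟪z, α⟫ * ⟪x, β⟫)) / (⟪α, α⟫ * ⟪β, β⟫)) := by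
      intro Z; field_simp; ring
    by_contra hneg
    push Not at hneg
    have := div_neg_of_neg_of_pos hneg (mul_pos hA hB)
    have e' := e ⟪z, x⟫
    linarith

/-- Along a minimal word heights go up. -/
lemma mini_increasing (hΦ : IsCrystalRootSystem Φ) (x : V n) (hx : ∀ r ∈ Φ, ⟪x, r⟫ ≠ 0)
    (l : List (V n ≃ₗ[ℝ] V n)) : ∀ a, Mini Φ x (a :: l) →
      ⟪(a :: l).prod x, x⟫ < ⟪l.prod x, x⟫ := by
  induction l with
  | nil =>
    intro a h
    obtain ⟨α, hα, ha⟩ := h.1 a (by simp)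
    have hA : 0 < ⟪α, α⟫ := real_inner_self_pos.2 (hΦ.ne_zero _ hα)
    simp only [List.prod_cons, List.prod_nil, mul_one]
    show ⟪a x, x⟫ < ⟪x, x⟫
    rw [height_refl ha]
    have := hx α hα
    have : 0 < ⟪x, α⟫ * ⟪x, α⟫ := mul_self_pos.2 this
    have : 0 < 2 * (⟪x, α⟫ * ⟪x, α⟫) / ⟪α, α⟫ := by positivity
    linarith
  | cons b l ih =>
    intro a h
    have hbm := h.1 b (by simp)
    have ham := h.1 a (by simp)
    have hbt := ih b h.tail
    have hlr : ∀ g ∈ l, g ∈ Refl Φ := fun g hg => h.1 g (by simp [hg])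
    have hreg := word_regular hΦ x hx (b :: l) h.tail.1
    obtain ⟨α, hα, ha⟩ := h.1 a (by simp)
    obtain ⟨β, hβ, hb⟩ := h.1 b (by simp)
    have hα0 := hΦ.ne_zero _ hα
    have hβ0 := hΦ.ne_zero _ hβ
    have hbb : b * b = 1 := mul_self hΦ hbm
    have haa : a * a = 1 := mul_self hΦ ham
    have hA : 0 < ⟪α, α⟫ := real_inner_self_pos.2 hα0
    set z := (b :: l).prod x with hz
    have hbz : b z = l.prod x := by
      rw [hz, List.prod_cons]
      exact refl_invol_apply hβ0 hb _
    have haz : (a :: b :: l).prod x = a z := by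
      rw [List.prod_cons]; rfl
    rw [haz]
    by_contra hcon
    push Not at hcon
    have hlt : ⟪z, x⟫ < ⟪a z, x⟫ := by
      refine lt_of_le_of_ne hcon ?_
      rw [height_refl ha]
      intro heq
      have h1 := hreg α hα
      have h2 := hx α hα
      have : 2 * (⟪z, α⟫ * ⟪x, α⟫) / ⟪α, α⟫ ≠ 0 := by positivity
      apply this
      linarith
    have hab : a ≠ b := by
      rintro rfl
      have := (h.2 l hlr (by simp [← mul_assoc, haa])).1
      simp at this
    rw [← hbz] at hbt
    rcases peak hα0 hβ0 ha hb hlt hbt hab with hp | hp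
    · -- replace a b by (a b a) a
      have := (h.2 ((a * b * a) :: a :: l) (by
        intro g hg
        simp only [List.mem_cons] at hg
        rcases hg with rfl | rfl | hg
        · exact conj_mem hΦ ham hbm
        · exact ham
        · exact hlr g hg) (by
          simp only [List.prod_cons]
          calc a * b * a * (a * l.prod) = a * b * (a * a) * l.prod := by simp only [mul_assoc]
            _ = _ := by rw [haa]; simp [mul_assoc])).2 (by simp)
      have e1 : ((a * b * a) :: a :: l).prod = (a :: b :: l).prod := by
        simp only [List.prod_cons]
        calc a * b * a * (a * l.prod) = a * b * (a * a) * l.prod := by simp only [mul_assoc]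
            _ = _ := by rw [haa]; simp [mul_assoc]
      have e2 : (a :: l).prod x = a (b z) := by
        rw [hbz, List.prod_cons]; rfl
      simp only [hsum] at this
      rw [e1, e2, ← hz] at this
      linarith
    · have e1 : (b :: (b * a * b) :: l).prod = (a :: b :: l).prod := by
        simp only [List.prod_cons]
        calc b * (b * a * b * l.prod) = (b * b) * (a * (b * l.prod)) := by simp only [mul_assoc]
            _ = _ := by rw [hbb]; simp
      have := (h.2 (b :: (b * a * b) :: l) (by
        intro g hg
        simp only [List.mem_cons] at hg
        rcases hg with rfl | rfl | hg
        · exact hbm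
        · exact conj_mem hΦ hbm ham
        · exact hlr g hg) e1).2 (by simp)
      have e2 : ((b * a * b) :: l).prod x = b (a z) := by
        rw [hz, List.prod_cons, List.prod_cons]; rfl
      simp only [hsum] at this
      rw [e1, e2, ← hz] at this
      linarith

lemma eq_one_of_fix_regular (hΦ : IsCrystalRootSystem Φ) (x : V n)
    (hx : ∀ r ∈ Φ, ⟪x, r⟫ ≠ 0) (l : List (V n ≃ₗ[ℝ] V n)) (hl : ∀ g ∈ l, g ∈ Refl Φ)
    (hfix : l.prod x = x) : l.prod = 1 := by
  have key : ∀ l : List (V n ≃ₗ[ℝ] V n), Mini Φ x l → l ≠ [] → ⟪l.prod x, x⟫ < ⟪x, x⟫ := by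
    intro l
    induction l with
    | nil => simp
    | cons a l ih =>
      intro h _
      have h1 := mini_increasing hΦ x hx l a h
      by_cases hl : l = []
      · subst hl; simpa using h1
      · exact h1.trans (ih h.tail hl)
  obtain ⟨l', hm, hp⟩ := exists_mini hΦ x l hl
  rw [← hp] at hfix ⊢
  by_cases h : l' = []
  · simp [h]
  · have := key l' hm h
    rw [hfix] at this
    exact absurd this (lt_irrefl _)

/-- Fixed space. -/
noncomputable def fixS (w : V n ≃ₗ[ℝ] V n) : Submodule ℝ (V n) :=
  LinearMap.ker (w.toLinearMap - LinearMap.id)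

lemma mem_fixS {w : V n ≃ₗ[ℝ] V n} {v : V n} : v ∈ fixS w ↔ w v = v := by
  simp [fixS, sub_eq_zero]

lemma mov_add_fix (w : V n ≃ₗ[ℝ] V n) :
    Module.finrank ℝ (movSet w) + Module.finrank ℝ (fixS w) = n := by
  have := LinearMap.finrank_range_add_finrank_ker (w.toLinearMap - LinearMap.id)
  rw [finrank_euclideanSpace_fin] at this
  exact this

lemma mov_eq (hΦ : IsCrystalRootSystem Φ) (l : List (V n ≃ₗ[ℝ] V n))
    (hl : ∀ g ∈ l, g ∈ Refl Φ) : movSet l.prod = (fixS l.prod)ᗮ := by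
  apply Submodule.eq_of_le_of_finrank_eq
  · rintro _ ⟨u, rfl⟩
    rw [Submodule.mem_orthogonal]
    intro f hf
    rw [mem_fixS] at hf
    have := word_inner hΦ l hl f u
    rw [hf] at this
    simp [inner_sub_right, this]
  · have h1 := mov_add_fix l.prod
    have h2 := (fixS l.prod).finrank_add_finrank_orthogonal
    simp at h2
    omega

lemma exists_root_mov (hΦ : IsCrystalRootSystem Φ) (l : List (V n ≃ₗ[ℝ] V n))
    (hl : ∀ g ∈ l, g ∈ Refl Φ) (hne : l.prod ≠ 1) : ∃ r ∈ Φ, r ∈ movSet l.prod := by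
  by_contra hcon
  push Not at hcon
  rw [mov_eq hΦ l hl] at hcon
  have : Finite Φ := hΦ.finite.to_subtype
  obtain ⟨x, hxF, hx⟩ := Module.Dual.exists_forall_mem_ne_zero_of_forall_exists (fixS l.prod)
    (fun r : Φ => (innerₛₗ ℝ (r : V n) : V n →ₗ[ℝ] ℝ)) (by
      rintro ⟨r, hr⟩
      have := hcon r hr
      rw [Submodule.mem_orthogonal] at this
      push Not at this
      obtain ⟨u, hu, hur⟩ := this
      exact ⟨u, hu, by simpa [real_inner_comm] using hur⟩)
  refine hne (eq_one_of_fix_regular hΦ x ?_ l hl (mem_fixS.1 hxF))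
  intro r hr
  have := hx ⟨r, hr⟩
  simpa [real_inner_comm] using this

lemma upper (hΦ : IsCrystalRootSystem Φ) (m : ℕ) : ∀ l : List (V n ≃ₗ[ℝ] V n),
    (∀ g ∈ l, g ∈ Refl Φ) → Module.finrank ℝ (movSet l.prod) = m →
    ∃ l' : List (V n ≃ₗ[ℝ] V n), l'.length ≤ m ∧ (∀ g ∈ l', g ∈ Refl Φ) ∧ l'.prod = l.prod := by
  induction m using Nat.strong_induction_on with
  | _ m ih =>
    intro l hl hm
    by_cases h1 : l.prod = 1
    · exact ⟨[], by simp, by simp, by simp [h1]⟩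
    obtain ⟨r, hr, v, hv⟩ := exists_root_mov hΦ l hl h1
    have hrm : r ∈ movSet l.prod := ⟨v, hv⟩
    have hr0 := hΦ.ne_zero r hr
    have hR : 0 < ⟪r, r⟫ := real_inner_self_pos.2 hr0
    obtain ⟨s, hs⟩ := exists_refl r
    have hsm : s ∈ Refl Φ := ⟨r, hr, hs⟩
    have hwv : l.prod v = v + r := by
      have : l.prod v - v = r := by simpa using hv
      rw [← this]; abel
    have hsv : (s :: l).prod v = v := by
      rw [List.prod_cons]
      show s (l.prod v) = v
      have := word_inner hΦ l hl v v
      rw [hwv, inner_add_left, inner_add_right, inner_add_right, real_inner_comm v r] at this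
      rw [hwv, hs, inner_add_left]
      have e : 2 * (⟪v, r⟫ + ⟪r, r⟫) / ⟪r, r⟫ = 1 := by
        rw [div_eq_one_iff_eq hR.ne']
        simp only [real_inner_comm] at this ⊢
        linarith
      rw [e]; simp
    have hl' : ∀ g ∈ s :: l, g ∈ Refl Φ := by
      intro g hg
      rcases List.mem_cons.1 hg with rfl | hg
      · exact hsm
      · exact hl g hg
    have hlt : fixS l.prod < fixS (s :: l).prod := by
      rw [SetLike.lt_iff_le_and_exists]
      refine ⟨?_, v, mem_fixS.2 hsv, ?_⟩
      · intro f hf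
        rw [mov_eq hΦ l hl, Submodule.mem_orthogonal] at hrm
        have hfr := hrm f hf
        rw [mem_fixS] at hf ⊢
        rw [List.prod_cons]
        show s (l.prod f) = f
        rw [hf, hs, hfr]
        simp
      · rw [mem_fixS, hwv]
        simpa using hr0
    have hd := Submodule.finrank_lt_finrank_of_lt hlt
    have e1 := mov_add_fix l.prod
    have e2 := mov_add_fix (s :: l).prod
    obtain ⟨l', a1, a2, a3⟩ := ih _ (by omega) (s :: l) hl' rfl
    refine ⟨s :: l', by simp only [List.length_cons]; omega, ?_, ?_⟩
    · intro g hg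
      rcases List.mem_cons.1 hg with rfl | hg
      · exact hsm
      · exact a2 g hg
    · rw [List.prod_cons, a3, List.prod_cons, ← mul_assoc, mul_self hΦ hsm, one_mul]

lemma mov_le_span (S : Set (V n)) (l : List (V n ≃ₗ[ℝ] V n))
    (hl : ∀ g ∈ l, ∃ β ∈ S, IsReflAlong β g) (v : V n) :
    l.prod v - v ∈ Submodule.span ℝ S := by
  induction l with
  | nil => simp
  | cons a l ih =>
    obtain ⟨α, hα, ha⟩ := hl a (by simp)
    have h1 := ih fun g hg => hl g (by simp [hg])
    rw [List.prod_cons]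
    show a (l.prod v) - v ∈ _
    rw [ha]
    have h2 := Submodule.smul_mem _ (2 * ⟪l.prod v, α⟫ / ⟪α, α⟫)
      (Submodule.subset_span (R := ℝ) hα)
    have h3 := Submodule.sub_mem _ h1 h2
    convert h3 using 1
    abel

lemma mov_finrank_le {k : ℕ} (β : Fin k → V n) (l : List (V n ≃ₗ[ℝ] V n))
    (hl : ∀ g ∈ l, ∃ b ∈ Set.range β, IsReflAlong b g) :
    Module.finrank ℝ (movSet l.prod) ≤ Module.finrank ℝ (Submodule.span ℝ (Set.range β)) := by
  apply Submodule.finrank_mono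
  rintro _ ⟨v, rfl⟩
  simpa using mov_le_span _ l hl v

lemma mov_finrank_le_length (l : List (V n ≃ₗ[ℝ] V n)) (hl : ∀ g ∈ l, g ∈ Refl Φ) :
    Module.finrank ℝ (movSet l.prod) ≤ l.length := by
  choose b hb1 hb2 using fun i : Fin l.length => hl (l.get i) (List.get_mem l i)
  refine (mov_finrank_le b l ?_).trans ((finrank_range_le_card b).trans (by simp))
  intro g hg
  obtain ⟨i, rfl⟩ := List.get_of_mem hg
  exact ⟨b i, ⟨i, rfl⟩, hb2 i⟩

lemma fix_orth {k : ℕ} : ∀ (β : Fin k → V n) (g : Fin k → (V n ≃ₗ[ℝ] V n)),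
    (∀ i, IsReflAlong (β i) (g i)) → LinearIndependent ℝ β → ∀ v : V n,
    (List.ofFn g).prod v = v → ∀ i, ⟪v, β i⟫ = 0 := by
  induction k with
  | zero => intro β g hg hi v hv i; exact i.elim0
  | succ k ih =>
    intro β g hg hi v hv
    have hβ0 : β 0 ≠ 0 := hi.ne_zero 0
    have hB : ⟪β 0, β 0⟫ ≠ 0 := by simpa using hβ0
    obtain ⟨hi1, hi2⟩ := linearIndependent_finSucc.1 hi
    rw [List.ofFn_succ, List.prod_cons] at hv
    set u := (List.ofFn fun i => g (Fin.succ i)).prod with hu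
    have hv' : g 0 (u v) = v := hv
    have huv : u v = g 0 v := by
      rw [← hv', refl_invol_apply hβ0 (hg 0), hv']
    have hsp : u v - v ∈ Submodule.span ℝ (Set.range (Fin.tail β)) := by
      apply mov_le_span
      intro h hh
      rw [List.mem_ofFn] at hh
      obtain ⟨i, rfl⟩ := hh
      exact ⟨β i.succ, ⟨i, rfl⟩, hg _⟩
    have h0 : ⟪v, β 0⟫ = 0 := by
      by_contra hne
      apply hi2
      rw [huv, hg 0] at hsp
      have hc : 2 * ⟪v, β 0⟫ / ⟪β 0, β 0⟫ ≠ 0 := by positivity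
      have e : v - (2 * ⟪v, β 0⟫ / ⟪β 0, β 0⟫) • β 0 - v
        = (-(2 * ⟪v, β 0⟫ / ⟪β 0, β 0⟫)) • β 0 := by
        rw [neg_smul]; abel
      rw [e] at hsp
      exact (Submodule.smul_mem_iff _ (neg_ne_zero.2 hc)).1 hsp
    have huv' : u v = v := by
      rw [huv, hg 0, h0]; simp
    have := ih (Fin.tail β) (fun i => g i.succ) (fun i => hg i.succ) hi1 v huv'
    intro i
    refine Fin.cases h0 (fun j => this j) i

end Carter

/-- **Carter's Lemma.** Let `Φ` be a finite crystallographic root system in `ℝⁿ`, let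
`g i` be the reflections corresponding to roots `β i ∈ Φ`, and let `w = g 0 * ⋯ * g (k-1)`.
Then the reflection length of `w` equals `k` iff `{β 0, …, β (k-1)}` is linearly
independent over `ℝ`. -/
theorem reflLen_eq_iff_linearIndependent {n k : ℕ} (Φ : Set (V n))
    (hΦ : IsCrystalRootSystem Φ) (β : Fin k → V n) (hβ : ∀ i, β i ∈ Φ)
    (g : Fin k → (V n ≃ₗ[ℝ] V n)) (hg : ∀ i, IsReflAlong (β i) (g i))
    (w : V n ≃ₗ[ℝ] V n) (hw : w = (List.ofFn g).prod) :
    reflLen Φ w = k ↔ LinearIndependent ℝ β := by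
  classical
  have hword : ∀ h ∈ List.ofFn g, h ∈ Carter.Refl Φ := by
    intro h hh
    rw [List.mem_ofFn] at hh
    obtain ⟨i, rfl⟩ := hh
    exact ⟨β i, hβ i, hg i⟩
  have hword' : ∀ h ∈ List.ofFn g, ∃ b ∈ Set.range β, IsReflAlong b h := by
    intro h hh
    rw [List.mem_ofFn] at hh
    obtain ⟨i, rfl⟩ := hh
    exact ⟨β i, ⟨i, rfl⟩, hg i⟩
  have hmemk : k ∈ {k | ∃ l : List (V n ≃ₗ[ℝ] V n), l.length = k ∧
      (∀ g ∈ l, ∃ β ∈ Φ, IsReflAlong β g) ∧ l.prod = w} :=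
    ⟨List.ofFn g, by simp, hword, hw.symm⟩
  constructor
  · intro hk
    obtain ⟨l', h1, h2, h3⟩ := Carter.upper hΦ _ (List.ofFn g) hword rfl
    have hle : reflLen Φ w ≤ l'.length := Nat.sInf_le ⟨l', rfl, h2, h3.trans hw.symm⟩
    rw [linearIndependent_iff_card_le_finrank_span, Fintype.card_fin]
    have h4 := Carter.mov_finrank_le β (List.ofFn g) hword'
    have h5 : k ≤ Module.finrank ℝ (Submodule.span ℝ (Set.range β)) := by omega
    exact h5
  · intro hi
    have hle : reflLen Φ w ≤ k := Nat.sInf_le hmemk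
    obtain ⟨l, h1, h2, h3⟩ := Nat.sInf_mem ⟨k, hmemk⟩
    have h4 := Carter.mov_finrank_le_length l h2
    have h5 : Carter.fixS w ≤ (Submodule.span ℝ (Set.range β))ᗮ := by
      intro v hv
      rw [Carter.mem_fixS, hw] at hv
      have h6 := Carter.fix_orth β g hg hi v hv
      rw [Submodule.mem_orthogonal']
      intro u hu
      induction hu using Submodule.span_induction with
      | mem x hx => obtain ⟨i, rfl⟩ := hx; exact h6 i
      | zero => simp
      | add x y _ _ hx hy => rw [inner_add_right, hx, hy, add_zero]
      | smul c x _ hx => rw [real_inner_smul_right, hx, mul_zero]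
    have h6 := Submodule.finrank_mono h5
    have h7 := (Submodule.span ℝ (Set.range β)).finrank_add_finrank_orthogonal
    rw [finrank_span_eq_card hi] at h7
    have h8 := Carter.mov_add_fix w
    simp only [Fintype.card_fin, finrank_euclideanSpace] at h7
    rw [h3] at h4
    have h9 : l.length = reflLen Φ w := h1
    omega
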